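/- arXiv:1612.08429 — 6 statements merged into one kernel-verified Lean document; each statement's English description precedes it below -/
import Mathlib

section
/- Let μ : D → U be an acyclic partial matching on a finite graded poset P. Define a relation ⊳₁ on P by: e ⊳₁ e' if and only if either e' ≤ e and it is not the case that e' ∈ D with μ(e') = e, or e ∈ D and e' = μ(e). Then the transitive closure ⊵ of ⊳₁ is a partial order on P; in particular ⊵ is antisymmetric: if e ⊵ e' and e' ⊵ e then e = e'. -/
/-- A partial matching on a poset `P`: a bijection `μ : D → U` between disjoint
subsets `D, U ⊆ P` such that `d ⋖ μ d` for every `d ∈ D`. -/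
structure PartialMatching (P : Type) [PartialOrder P] where
  D : Set P
  U : Set P
  m : P → P
  minv : P → P
  disj : Disjoint D U
  m_mem : ∀ d ∈ D, m d ∈ U
  minv_mem : ∀ u ∈ U, minv u ∈ D
  left_inv : ∀ d ∈ D, minv (m d) = d
  right_inv : ∀ u ∈ U, m (minv u) = u
  cov : ∀ d ∈ D, d ⋖ m d

namespace PartialMatching

variable {P : Type} [PartialOrder P]

/-- The set of critical elements. -/
def Cr (M : PartialMatching P) : Set P := (M.D ∪ M.U)ᶜ

/-- A partial matching is acyclic if every Forman path is a gradient path. -/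
def IsAcyclic (M : PartialMatching P) : Prop :=
  ∀ (n : ℕ) (d : ℕ → P), 1 ≤ n →
    (∀ i j, i < n → j < n → d i = d j → i = j) →
    (∀ i, i < n → d i ∈ M.D) →
    (∀ i, i + 1 < n → d (i + 1) ⋖ M.m (d i)) →
    n = 1 ∨ ¬ d 0 ⋖ M.m (d (n - 1))

/-- A faithful discrete Morse function adapted to `M`. -/
def Faithful (M : PartialMatching P) (f : P → ℤ) : Prop :=
  Function.Injective f ∧
  (∀ d ∈ M.D, f (M.m d) < f d) ∧
  ∀ e e' : P, e < e' → ¬(e ∈ M.D ∧ e' = M.m e) → f e < f e'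

end PartialMatching

/-- The data of a flow path `(e₁,u₁,…,e_n,u_n;c)`: the list of pairs
`steps = [(e₁,u₁),…,(e_n,u_n)]` and the final (critical) cell `c`. -/
structure FlowPath (P : Type) where
  steps : List (P × P)
  c : P

namespace FlowPath

variable {P : Type} [PartialOrder P]

/-- The length `ℓ(γ) = n` of a flow path. -/
def len (γ : FlowPath P) : ℕ := γ.steps.length

/-- `eAt γ i = e_{i+1}` (0-based); by convention `eAt γ i = c` for `i ≥ len γ`. -/
def eAt (γ : FlowPath P) (i : ℕ) : P := (γ.steps.map Prod.fst).getD i γ.c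

/-- `uAt γ i = u_{i+1}` (0-based). -/
def uAt (γ : FlowPath P) (i : ℕ) : P := (γ.steps.map Prod.snd).getD i γ.c

/-- The initial cell `ι(γ)` (equal to `c` when `len γ = 0`). -/
def init (γ : FlowPath P) : P := γ.eAt 0

/-- The target `τ(γ) = c`. -/
def tgt (γ : FlowPath P) : P := γ.c

/-- `γ` is a genuine flow path with respect to the matching `M`. -/
def Valid (M : PartialMatching P) (γ : FlowPath P) : Prop :=
  γ.c ∈ M.Cr ∧
  ∀ i, i < γ.len →
    γ.uAt i ∈ M.U ∧
    (γ.eAt i = γ.uAt i ∨ γ.eAt i = M.minv (γ.uAt i)) ∧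
    γ.eAt (i + 1) < γ.uAt i ∧
    γ.eAt (i + 1) ≠ M.minv (γ.uAt i)

/-- `φ : {0,…,k} → {0,…,ℓ(γ')+1}` is an embedding function for `γ ⪯ γ'`.
Indices of cells are 1-based as in the paper, so the paper's `e_j` is `eAt γ (j-1)`. -/
def IsEmbed (γ γ' : FlowPath P) (k : ℕ) (φ : ℕ → ℕ) : Prop :=
  1 ≤ k ∧ k ≤ γ.len + 1 ∧
  (∀ i j, i < j → j ≤ k → φ i < φ j) ∧
  φ 0 = 0 ∧ φ k = γ'.len + 1 ∧
  (∀ j, 1 ≤ j → j < k → γ.uAt (j - 1) = γ'.uAt (φ j - 1)) ∧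
  (∀ j p, 1 ≤ j → j ≤ k → φ (j - 1) < p → p ≤ φ j → γ.eAt (j - 1) ≤ γ'.eAt (p - 1))

/-- The subpath relation `γ ⪯ γ'`. -/
def Subpath (γ γ' : FlowPath P) : Prop := ∃ k φ, IsEmbed γ γ' k φ

/-- `γ` is reducible at `i` (0-based; the paper's index is `i+1`). -/
def ReducibleAt (M : PartialMatching P) (γ : FlowPath P) (i : ℕ) : Prop :=
  i < γ.len ∧ γ.eAt (i + 1) < M.minv (γ.uAt i)

/-- `γ` is reduced: it is reducible at no index. -/
def Reduced (M : PartialMatching P) (γ : FlowPath P) : Prop :=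
  ∀ i, ¬ ReducibleAt M γ i

/-- Concatenation `γ * δ` of flow paths. -/
def concat (γ δ : FlowPath P) : FlowPath P := ⟨γ.steps ++ δ.steps, δ.c⟩

/-- The collapse `τ(γ ⪯ γ')`: the tail of `γ` starting at its (1-based) `k`-th cell. -/
def collapse (γ : FlowPath P) (k : ℕ) : FlowPath P := ⟨γ.steps.drop (k - 1), γ.c⟩

/-- `rγ` is the reduction of `γ`: the greatest reduced flow path `⪯ γ`. -/
def IsReduction (M : PartialMatching P) (γ rγ : FlowPath P) : Prop :=
  Valid M rγ ∧ Reduced M rγ ∧ Subpath rγ γ ∧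
  ∀ δ, Valid M δ → Reduced M δ → Subpath δ γ → Subpath δ rγ

end FlowPath

/-- The relation `e ⊳₁ e'`. -/
def rhdOne {P : Type} [PartialOrder P] (M : PartialMatching P) (e e' : P) : Prop :=
  (e' ≤ e ∧ ¬(e' ∈ M.D ∧ M.m e' = e)) ∨ (e ∈ M.D ∧ e' = M.m e)

theorem strictMono_of_covBy_eq_succ {P : Type} [PartialOrder P] [Finite P] {rk : P → ℕ}
    (hrk : ∀ a b : P, a ⋖ b → rk b = rk a + 1) : StrictMono rk := by
  intro a
  induction a using WellFoundedGT.induction with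
  | ind a ih =>
    intro b hab
    obtain ⟨c, hac, hcb⟩ := exists_covBy_le_of_lt hab
    have hc := hrk a c hac
    rcases hcb.eq_or_lt with rfl | hlt
    · omega
    · have := ih c hac.lt hlt
      omega

theorem Relation.TransGen.exists_walk {α : Type*} {r : α → α → Prop} {a b : α}
    (h : Relation.TransGen r a b) :
    ∃ (n : ℕ) (f : ℕ → α), 1 ≤ n ∧ f 0 = a ∧ f n = b ∧ ∀ i < n, r (f i) (f (i + 1)) := by
  induction h using Relation.TransGen.head_induction_on with
  | @single a h =>
    refine ⟨1, fun i => Nat.casesOn i a fun _ => b, le_rfl, rfl, rfl, fun i hi => ?_⟩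
    obtain rfl : i = 0 := by omega
    exact h
  | @head a c h _ ih =>
    obtain ⟨n, f, _, h0, hb, hf⟩ := ih
    refine ⟨n + 1, fun i => Nat.casesOn i a f, by omega, rfl, hb, fun i hi => ?_⟩
    cases i with
    | zero => simpa [h0] using h
    | succ i => exact hf i (by omega)

/-- A relation with a cycle has a cycle without repeated vertices. -/
theorem Relation.TransGen.exists_simple_cycle {α : Type*} {r : α → α → Prop} {a : α}
    (h : Relation.TransGen r a a) :
    ∃ (n : ℕ) (f : ℕ → α), 1 ≤ n ∧ f n = f 0 ∧ (∀ i < n, r (f i) (f (i + 1))) ∧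
      ∀ i j, i < n → j < n → f i = f j → i = j := by
  classical
  have hex : ∃ n, ∃ f : ℕ → α, 1 ≤ n ∧ f n = f 0 ∧ ∀ i < n, r (f i) (f (i + 1)) := by
    obtain ⟨n, f, hn, h0, hb, hf⟩ := h.exists_walk
    exact ⟨n, f, hn, hb.trans h0.symm, hf⟩
  obtain ⟨f, hn, hf0, hf⟩ := Nat.find_spec hex
  have hne : ∀ i j, i < j → j < Nat.find hex → f i ≠ f j := by
    intro i j hij hj heq
    refine Nat.find_min hex (m := j - i) (by omega)
      ⟨fun k => f (i + k), by omega, ?_, fun k hk => hf (i + k) (by omega)⟩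
    simp only [Nat.add_sub_cancel' hij.le, add_zero, heq]
  refine ⟨_, f, hn, hf0, hf, fun i j hi hj heq => ?_⟩
  rcases lt_trichotomy i j with hlt | rfl | hlt
  · exact (hne i j hlt hj heq).elim
  · rfl
  · exact (hne j i hlt hi heq.symm).elim

namespace PartialMatching

variable {P : Type} [PartialOrder P]

/-- One step of a Forman path between distinct elements of `D`. -/
def FormanStep (M : PartialMatching P) (d d' : P) : Prop :=
  d ∈ M.D ∧ d' ∈ M.D ∧ d' ⋖ M.m d ∧ d' ≠ d

theorem IsAcyclic.not_transGen_formanStep {M : PartialMatching P} (hM : M.IsAcyclic) (d : P) :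
    ¬ Relation.TransGen M.FormanStep d d := by
  intro h
  obtain ⟨n, f, hn, hf0, hf, hinj⟩ := h.exists_simple_cycle
  have hlast := hf (n - 1) (by omega)
  rw [Nat.sub_add_cancel hn, hf0] at hlast
  rcases hM n f hn hinj (fun i hi => (hf i hi).1)
    (fun i hi => (hf i (by omega)).2.2.1) with rfl | hnot
  · exact hlast.2.2.2 rfl
  · exact hnot hlast.2.2.1

theorem notMem_D_of_mem_U (M : PartialMatching P) {u : P} (hu : u ∈ M.U) : u ∉ M.D :=
  fun hd => Set.disjoint_left.mp M.disj hd hu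

/-- A step of `⊳₁` which is part of an alternating path between two consecutive ranks. -/
def AltStep (M : PartialMatching P) (x y : P) : Prop :=
  (x ∈ M.D ∧ y = M.m x) ∨ (x ∉ M.D ∧ y ∈ M.D ∧ y ⋖ x ∧ M.m y ≠ x)

theorem formanStep_of_transGen_altStep (M : PartialMatching P) {d x : P} (hd : d ∈ M.D)
    (h : Relation.TransGen M.AltStep d x) :
    (x ∈ M.D ∧ Relation.TransGen M.FormanStep d x) ∨
      ∃ d' ∈ M.D, Relation.ReflTransGen M.FormanStep d d' ∧ x = M.m d' := by
  induction h with
  | single h =>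
    rcases h with ⟨_, rfl⟩ | ⟨hn, _⟩
    · exact Or.inr ⟨d, hd, .refl, rfl⟩
    · exact (hn hd).elim
  | tail _ h ih =>
    rcases h with ⟨hx, rfl⟩ | ⟨hx, hy, hcov, hne⟩
    · rcases ih with ⟨_, hT⟩ | ⟨d', hd', _, rfl⟩
      · exact Or.inr ⟨_, hx, hT.to_reflTransGen, rfl⟩
      · exact (M.notMem_D_of_mem_U (M.m_mem d' hd') hx).elim
    · rcases ih with ⟨hx', _⟩ | ⟨d', hd', hT, rfl⟩
      · exact (hx hx').elim
      · exact Or.inl ⟨hy, Relation.TransGen.tail' hT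
          ⟨hd', hy, hcov, fun h => hne (h ▸ rfl)⟩⟩

theorem IsAcyclic.not_transGen_altStep {M : PartialMatching P} (hM : M.IsAcyclic) (x : P) :
    ¬ Relation.TransGen M.AltStep x x := by
  have key : ∀ d ∈ M.D, ¬ Relation.TransGen M.AltStep d d := by
    intro d hd h
    rcases M.formanStep_of_transGen_altStep hd h with ⟨_, hT⟩ | ⟨d', hd', _, heq⟩
    · exact hM.not_transGen_formanStep d hT
    · exact M.notMem_D_of_mem_U (M.m_mem d' hd') (heq ▸ hd)
  intro h
  by_cases hx : x ∈ M.D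
  · exact key x hx h
  · obtain ⟨y, hxy, hyx⟩ := Relation.TransGen.head'_iff.mp h
    rcases hxy with ⟨hx', _⟩ | hxy
    · exact hx hx'
    · exact key y hxy.2.1 (Relation.TransGen.tail' hyx (Or.inr hxy))

open Classical in
/-- The rank, raised by one on `D`, so that matched elements share the same level. -/
noncomputable def level (M : PartialMatching P) (rk : P → ℕ) (e : P) : ℕ :=
  if e ∈ M.D then rk e + 1 else rk e

theorem rhdOne_cases [Finite P] (M : PartialMatching P) {rk : P → ℕ}
    (hrk : ∀ a b : P, a ⋖ b → rk b = rk a + 1) {e e' : P} (h : rhdOne M e e') :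
    M.level rk e' < M.level rk e ∨ e = e' ∨ (M.level rk e' = M.level rk e ∧ M.AltStep e e') := by
  have hmono := strictMono_of_covBy_eq_succ hrk
  rcases h with ⟨hle, hn⟩ | ⟨hd, rfl⟩
  · rcases hle.eq_or_lt with rfl | hlt
    · exact Or.inr (Or.inl rfl)
    have hr := hmono hlt
    by_cases hL : M.level rk e' < M.level rk e
    · exact Or.inl hL
    have hcases : e ∉ M.D ∧ e' ∈ M.D ∧ rk e = rk e' + 1 := by
      unfold level at hL
      split_ifs at hL with h1 h2 h2
      all_goals first | omega | exact ⟨h2, h1, by omega⟩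
    obtain ⟨he, he', hrank⟩ := hcases
    refine Or.inr (Or.inr ⟨by simp [level, he, he', hrank], Or.inr ⟨he, he', ⟨hlt, ?_⟩, ?_⟩⟩)
    · intro c h1 h2
      have := hmono h1
      have := hmono h2
      omega
    · exact fun h => hn ⟨he', h⟩
  · have hu := M.notMem_D_of_mem_U (M.m_mem e hd)
    exact Or.inr (Or.inr ⟨by simp [level, hd, hu, hrk _ _ (M.cov e hd)], Or.inl ⟨hd, rfl⟩⟩)

theorem transGen_rhdOne_cases [Finite P] (M : PartialMatching P) {rk : P → ℕ}
    (hrk : ∀ a b : P, a ⋖ b → rk b = rk a + 1) {e e' : P}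
    (h : Relation.TransGen (rhdOne M) e e') :
    M.level rk e' < M.level rk e ∨ e = e' ∨
      (M.level rk e' = M.level rk e ∧ Relation.TransGen M.AltStep e e') := by
  induction h with
  | single h => exact (M.rhdOne_cases hrk h).imp_right (Or.imp_right (And.imp_right .single))
  | tail _ h ih =>
    rcases M.rhdOne_cases hrk h with h | rfl | ⟨hL, h⟩
    · rcases ih with ih | rfl | ih
      · exact Or.inl (h.trans ih)
      · exact Or.inl h
      · exact Or.inl (ih.1 ▸ h)
    · exact ih
    · rcases ih with ih | rfl | ih
      · exact Or.inl (hL ▸ ih)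
      · exact Or.inr (Or.inr ⟨hL, .single h⟩)
      · exact Or.inr (Or.inr ⟨hL.trans ih.1, ih.2.tail h⟩)

theorem IsAcyclic.antisymm_transGen_rhdOne [Finite P] {M : PartialMatching P} (hM : M.IsAcyclic)
    {rk : P → ℕ} (hrk : ∀ a b : P, a ⋖ b → rk b = rk a + 1) {e e' : P}
    (h : Relation.TransGen (rhdOne M) e e') (h' : Relation.TransGen (rhdOne M) e' e) :
    e = e' := by
  rcases M.transGen_rhdOne_cases hrk h with h | h | ⟨hL, h⟩
  · rcases M.transGen_rhdOne_cases hrk h' with h' | h' | ⟨hL', _⟩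
    · omega
    · exact h'.symm
    · omega
  · exact h
  · rcases M.transGen_rhdOne_cases hrk h' with h' | h' | ⟨_, h'⟩
    · omega
    · exact h'.symm
    · exact (hM.not_transGen_altStep e (h.trans h')).elim

/-- An element is never its own match, so `⊳₁` is reflexive. -/
theorem rhdOne_refl (M : PartialMatching P) (e : P) : rhdOne M e e :=
  Or.inl ⟨le_rfl, fun h => (M.cov e h.1).lt.ne h.2.symm⟩

end PartialMatching

/-- the transitive closure `⊵` of `⊳₁` is a partial order on `P`;
in particular it is antisymmetric. -/
theorem stmt0 {P : Type} [PartialOrder P] [Fintype P]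
    (rk : P → ℕ) (hrk : ∀ a b : P, a ⋖ b → rk b = rk a + 1)
    (M : PartialMatching P) (hM : M.IsAcyclic) :
    IsPartialOrder P (Relation.TransGen (rhdOne M)) ∧
    ∀ e e' : P, Relation.TransGen (rhdOne M) e e' →
      Relation.TransGen (rhdOne M) e' e → e = e' := by
  have hanti : ∀ e e' : P, Relation.TransGen (rhdOne M) e e' →
      Relation.TransGen (rhdOne M) e' e → e = e' :=
    fun _ _ h h' => hM.antisymm_transGen_rhdOne hrk h h'
  exact ⟨{ refl := fun e => .single (M.rhdOne_refl e)
           trans := fun _ _ _ => .trans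
           antisymm := hanti }, hanti⟩
end

section
/- Let μ : D → U be an acyclic partial matching on a finite graded poset P. Then there exists a faithful discrete Morse function adapted to μ, i.e., an injective function f : P → ℤ with f(d) > f(μ(d)) for every d ∈ D and f(e) < f(e') whenever e < e' and it is not the case that e ∈ D with e' = μ(e). -/
/-- The Forman step relation: `a` follows `b` in a Forman path and is not equal to it. -/
def PartialMatching.FormanStep_s2 {P : Type} [PartialOrder P] (M : PartialMatching P)
    (a b : P) : Prop :=
  a ∈ M.D ∧ b ∈ M.D ∧ a ≠ b ∧ a ⋖ M.m b

theorem PartialMatching.IsAcyclic.wellFounded_formanStep {P : Type} [PartialOrder P] [Finite P]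
    {M : PartialMatching P} (hM : M.IsAcyclic) : WellFounded M.FormanStep_s2 := by
  classical
  rw [wellFounded_iff_isEmpty_descending_chain]
  refine ⟨fun ⟨d, hd⟩ => ?_⟩
  have hex : ∃ n, 0 < n ∧ ∃ i, d i = d (i + n) := by
    obtain ⟨i, j, hij, h⟩ := Finite.exists_ne_map_eq_of_infinite d
    rcases lt_or_gt_of_ne hij with hlt | hlt
    · exact ⟨j - i, by omega, i, by rw [h]; congr 1; omega⟩
    · exact ⟨i - j, by omega, j, by rw [← h]; congr 1; omega⟩
  obtain ⟨hn, i, hi⟩ := Nat.find_spec hex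
  have hmin := fun k => Nat.find_min hex (m := k)
  generalize Nat.find hex = n at hn hi hmin
  have hinj : ∀ j k, j < k → k < n → d (i + j) ≠ d (i + k) := fun j k hjk hk h =>
    hmin (k - j) (by omega)
      ⟨by omega, i + j, by rw [h]; congr 1; omega⟩
  rcases hM n (fun j => d (i + j)) hn
    (fun j k hj hk h => by
      rcases lt_trichotomy j k with hlt | rfl | hlt
      · exact (hinj j k hlt hk h).elim
      · rfl
      · exact (hinj k j hlt hj h.symm).elim)
    (fun j _ => (hd (i + j)).2.1) (fun j _ => (hd (i + j)).2.2.2) with h | h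
  · subst h
    exact (hd i).2.2.1 hi.symm
  · apply h
    have hlast := (hd (i + (n - 1))).2.2.2
    rwa [show i + (n - 1) + 1 = i + n by omega, ← hi] at hlast

theorem WellFounded.exists_nat_strictMono {α : Type*} [Finite α] {r : α → α → Prop}
    (hr : WellFounded r) :
    ∃ (h : α → ℕ) (B : ℕ), (∀ a, h a < B) ∧ ∀ a b, r a b → h a < h b := by
  refine ⟨fun a => {x | Relation.TransGen r x a}.ncard, Nat.card α + 1,
    fun a => Nat.lt_succ_of_le (Set.ncard_le_card _), fun a b hab => ?_⟩
  refine Set.ncard_lt_ncard ⟨fun x hx => hx.tail hab, fun hsub => ?_⟩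
  exact hr.transGen.irrefl.irrefl a (hsub (Relation.TransGen.single hab))

/-- Every weight on a finite type is refined by an injective one. -/
theorem exists_injective_int_refining {α : Type*} [Fintype α] (g : α → ℕ) :
    ∃ f : α → ℤ, Function.Injective f ∧ ∀ a b, g a < g b → f a < f b := by
  let e := Fintype.equivFin α
  have hlt : ∀ a b, g a < g b →
      ((g a * Fintype.card α + e a : ℕ) : ℤ) < (g b * Fintype.card α + e b : ℕ) := by
    intro a b hab
    have ha := (e a).isLt
    have := Nat.mul_le_mul_right (Fintype.card α) (Nat.succ_le_of_lt hab)
    rw [Nat.succ_mul] at this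
    exact_mod_cast (by omega)
  refine ⟨fun a => (g a * Fintype.card α + e a : ℕ), fun a b hab => ?_, hlt⟩
  rcases lt_trichotomy (g a) (g b) with h | h | h
  · exact absurd hab (hlt a b h).ne
  · apply e.injective
    apply Fin.ext
    simpa [h] using hab
  · exact absurd hab (hlt b a h).ne'

theorem strictMono_of_covBy {P : Type*} [PartialOrder P] [Finite P] {rk : P → ℕ}
    (hrk : ∀ a b : P, a ⋖ b → rk b = rk a + 1) : StrictMono rk := by
  have := Fintype.ofFinite P
  classical
  have := Fintype.toLocallyFiniteOrder (α := P)
  exact (strictMono_iff_forall_covBy rk).2 fun a b hab => by rw [hrk a b hab]; omega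

theorem covBy_of_lt_of_eq_add_one {P : Type*} [PartialOrder P] {rk : P → ℕ} (hrk : StrictMono rk)
    {a b : P} (hab : a < b) (h : rk b = rk a + 1) : a ⋖ b :=
  ⟨hab, fun c hac hcb => by have := hrk hac; have := hrk hcb; omega⟩

/-- existence of a faithful discrete Morse function adapted to `μ`. -/
theorem stmt2 {P : Type} [PartialOrder P] [Fintype P]
    (rk : P → ℕ) (hrk : ∀ a b : P, a ⋖ b → rk b = rk a + 1)
    (M : PartialMatching P) (hM : M.IsAcyclic) :
    ∃ f : P → ℤ, Function.Injective f ∧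
      (∀ d ∈ M.D, f (M.m d) < f d) ∧
      ∀ e e' : P, e < e' → ¬(e ∈ M.D ∧ e' = M.m e) → f e < f e' := by
  classical
  have hmono := strictMono_of_covBy hrk
  obtain ⟨h, B, hB, hh⟩ := hM.wellFounded_formanStep.exists_nat_strictMono
  -- Matched pairs share a level between those of their two ranks, and are sorted there by `h`.
  let g : P → ℕ := fun x =>
    if x ∈ M.D then (2 * rk x + 1) * (2 * B) + (2 * h x + 1)
    else if x ∈ M.U then (2 * rk x - 1) * (2 * B) + 2 * h (M.minv x)
    else 2 * rk x * (2 * B)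
  have hgD : ∀ x ∈ M.D, g x = (2 * rk x + 1) * (2 * B) + (2 * h x + 1) := fun x hx => if_pos hx
  have hgm : ∀ x ∈ M.D, g (M.m x) = (2 * rk x + 1) * (2 * B) + 2 * h x := fun x hx => by
    have hU := M.m_mem x hx
    have hD : M.m x ∉ M.D := fun hD => Set.disjoint_left.1 M.disj hD hU
    simp only [g, if_neg hD, if_pos hU, M.left_inv x hx, hrk _ _ (M.cov x hx)]
    congr 2
  have hgC : ∀ x, x ∉ M.D → x ∉ M.U → g x = 2 * rk x * (2 * B) := fun x hD hU => by
    simp only [g, if_neg hD, if_neg hU]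
  have hlevel : ∀ {k l s t : ℕ}, k < l → s < 2 * B →
      k * (2 * B) + s < l * (2 * B) + t := fun {k l s t} hkl hs => by
    have := Nat.mul_le_mul_right (2 * B) (Nat.succ_le_of_lt hkl)
    rw [Nat.succ_mul] at this
    omega
  have hcases : ∀ x, (x ∈ M.D) ∨ (∃ d ∈ M.D, x = M.m d) ∨ (x ∉ M.D ∧ x ∉ M.U) := fun x => by
    by_cases hD : x ∈ M.D
    · exact Or.inl hD
    by_cases hU : x ∈ M.U
    · exact Or.inr (Or.inl ⟨_, M.minv_mem x hU, (M.right_inv x hU).symm⟩)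
    · exact Or.inr (Or.inr ⟨hD, hU⟩)
  have hform : ∀ x, ∃ k s, g x = k * (2 * B) + s ∧ s < 2 * B ∧
      2 * rk x ≤ k + 1 ∧ k ≤ 2 * rk x + 1 ∧
      (k = 2 * rk x + 1 → x ∈ M.D) ∧ (k + 1 = 2 * rk x → ∃ d ∈ M.D, x = M.m d) := fun x => by
    rcases hcases x with hx | ⟨d, hd, rfl⟩ | ⟨hD, hU⟩
    · have := hB x
      exact ⟨_, _, hgD x hx, by omega, by omega, by omega, fun _ => hx, fun _ => by omega⟩
    · have := hB d
      have := hrk _ _ (M.cov d hd)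
      exact ⟨_, _, hgm d hd, by omega, by omega, by omega, fun _ => by omega,
        fun _ => ⟨d, hd, rfl⟩⟩
    · have := hB x
      exact ⟨_, 0, hgC x hD hU, by omega, by omega, by omega, fun _ => by omega,
        fun _ => by omega⟩
  obtain ⟨f, hinj, hf⟩ := exists_injective_int_refining g
  refine ⟨f, hinj, fun d hd => hf _ _ ?_, fun a b hab hne => hf _ _ ?_⟩
  · rw [hgD d hd, hgm d hd]
    omega
  · have hrank := hmono hab
    obtain ⟨k, s, hga, hs, -, hk, hka, -⟩ := hform a
    obtain ⟨l, t, hgb, -, hl, -, -, hlb⟩ := hform b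
    rcases lt_or_ge k l with hkl | hlk
    · rw [hga, hgb]
      exact hlevel hkl hs
    · have ha := hka (by omega)
      obtain ⟨d, hd, rfl⟩ := hlb (by omega)
      have hcov := covBy_of_lt_of_eq_add_one hmono hab (by omega)
      have hlt := hh a d ⟨ha, hd, fun had => hne ⟨ha, by rw [had]⟩, hcov⟩
      have hrk_eq : rk a = rk d := by
        have := hrk _ _ hcov
        have := hrk _ _ (M.cov d hd)
        omega
      rw [hgD a ha, hgm d hd, hrk_eq]
      omega
end

section
/- Let μ be an acyclic partial matching on a finite graded poset P and γ = (e₁, u₁, …, e_n, u_n; c) a flow path that is reducible at i, i.e., e_{i+1} < μ⁻¹(u_i) (with e_{n+1} = c). Then the sequence r_i(γ) = (e₁, u₁, …, e_{i−1}, u_{i−1}, e_{i+1}, u_{i+1}, …, e_n, u_n; c) obtained by deleting the pair (e_i, u_i) is again a flow path. -/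
namespace FlowPath

variable {P : Type}

theorem eAt_eraseIdx (γ : FlowPath P) (i j : ℕ) :
    eAt ⟨γ.steps.eraseIdx i, γ.c⟩ j = if j < i then γ.eAt j else γ.eAt (j + 1) := by
  simp only [eAt, List.getD_eq_getElem?_getD, List.getElem?_map, List.getElem?_eraseIdx]
  split <;> rfl

theorem uAt_eraseIdx (γ : FlowPath P) (i j : ℕ) :
    uAt ⟨γ.steps.eraseIdx i, γ.c⟩ j = if j < i then γ.uAt j else γ.uAt (j + 1) := by
  simp only [uAt, List.getD_eq_getElem?_getD, List.getElem?_map, List.getElem?_eraseIdx]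
  split <;> rfl

theorem len_eraseIdx (γ : FlowPath P) {i : ℕ} (hi : i < γ.len) :
    len ⟨γ.steps.eraseIdx i, γ.c⟩ = γ.len - 1 :=
  List.length_eraseIdx_of_lt hi

end FlowPath

namespace PartialMatching

theorem minv_covBy {P : Type} [PartialOrder P] (M : PartialMatching P) {u : P} (hu : u ∈ M.U) : M.minv u ⋖ u := by
  simpa only [M.right_inv u hu] using M.cov _ (M.minv_mem u hu)

end PartialMatching

/-- if `γ` is reducible at `i`, the sequence `r_i(γ)` obtained by deleting
the pair `(e_i, u_i)` is again a flow path. (Indices are 0-based here: the paper's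
pair `(e_{i+1}, u_{i+1})` is `γ.steps[i]`.) -/
theorem stmt4 {P : Type} [PartialOrder P] [Fintype P]
    (rk : P → ℕ) (hrk : ∀ a b : P, a ⋖ b → rk b = rk a + 1)
    (M : PartialMatching P) (hM : M.IsAcyclic)
    (γ : FlowPath P) (hγ : γ.Valid M) (i : ℕ) (hred : γ.ReducibleAt M i) :
    FlowPath.Valid M ⟨γ.steps.eraseIdx i, γ.c⟩ := by
  obtain ⟨hi, hlt⟩ := hred
  obtain ⟨hc, hstep⟩ := hγ
  refine ⟨hc, fun j hj => ?_⟩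
  rw [γ.len_eraseIdx hi] at hj
  simp only [FlowPath.eAt_eraseIdx, FlowPath.uAt_eraseIdx]
  rcases lt_trichotomy (j + 1) i with h | rfl | h
  · simpa only [h, (Nat.lt_succ_self j).trans h, if_true] using hstep j (by omega)
  · obtain ⟨hu, he, hlt', -⟩ := hstep j (by omega)
    obtain ⟨hu', he', -, -⟩ := hstep (j + 1) hi
    have hle : M.minv (γ.uAt (j + 1)) ≤ γ.eAt (j + 1) := by
      rcases he' with h | h
      · exact h ▸ (M.minv_covBy hu').le
      · exact h.ge
    have hlt_e : γ.eAt (j + 1 + 1) < γ.eAt (j + 1) := hlt.trans_le hle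
    simp only [lt_irrefl, Nat.lt_succ_self, if_true, if_false]
    refine ⟨hu, he, hlt_e.trans hlt', fun heq => ?_⟩
    exact (M.minv_covBy hu).2 (heq ▸ hlt_e) hlt'
  · have h₁ : ¬ j < i := by omega
    have h₂ : ¬ j + 1 < i := by omega
    simpa only [h₁, h₂, if_false] using hstep (j + 1) (by omega)
end

section
/- Let μ be an acyclic partial matching on a finite graded poset P and f a faithful discrete Morse function adapted to μ. For all flow paths γ, γ' ∈ FP(μ), if γ ⪯ γ' then f(τ(γ)) ≤ f(τ(γ')). -/
namespace FlowPath

/-- The cell after the last step is the target. -/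
theorem eAt_len {P : Type} (γ : FlowPath P) : γ.eAt γ.len = γ.c := by
  simp [eAt, len, List.getD]

variable {P : Type} [PartialOrder P] {M : PartialMatching P} {f : P → ℤ}

/-- A faithful discrete Morse function strictly decreases along each step of a flow path. -/
theorem Valid.apply_eAt_succ_lt {γ : FlowPath P} (hγ : γ.Valid M) (hf : M.Faithful f) {i : ℕ}
    (hi : i < γ.len) : f (γ.eAt (i + 1)) < f (γ.eAt i) := by
  obtain ⟨hU, he, hlt, hne⟩ := hγ.2 i hi
  have hdown : f (γ.eAt (i + 1)) < f (γ.uAt i) :=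
    hf.2.2 _ _ hlt fun ⟨hD, hm⟩ => hne (by rw [hm, M.left_inv _ hD])
  rcases he with he | he
  · rwa [he]
  · have hup := hf.2.1 _ (M.minv_mem _ hU)
    rw [M.right_inv _ hU] at hup
    rw [he]
    exact hdown.trans hup

/-- The target of a flow path minimises a faithful discrete Morse function among its cells. -/
theorem Valid.apply_tgt_le {γ : FlowPath P} (hγ : γ.Valid M) (hf : M.Faithful f) {i : ℕ}
    (hi : i ≤ γ.len) : f γ.tgt ≤ f (γ.eAt i) := by
  induction hi using Nat.decreasingInduction with
  | self => rw [eAt_len, tgt]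
  | of_succ k hk ih => exact ih.trans (hγ.apply_eAt_succ_lt hf hk).le

end FlowPath

/-- A faithful discrete Morse function is monotone below critical cells. -/
theorem PartialMatching.Faithful.le_of_le_critical {P : Type} [PartialOrder P]
    {M : PartialMatching P} {f : P → ℤ} (hf : M.Faithful f) {e c : P} (hc : c ∈ M.Cr)
    (h : e ≤ c) : f e ≤ f c := by
  rcases h.eq_or_lt with rfl | h
  · rfl
  · exact (hf.2.2 _ _ h fun ⟨hD, hm⟩ => hc (Or.inr (hm ▸ M.m_mem _ hD))).le

/-- if `γ ⪯ γ'` then `f(τ(γ)) ≤ f(τ(γ'))` for a faithful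
discrete Morse function `f` adapted to `μ`. -/
theorem stmt6 {P : Type} [PartialOrder P] [Fintype P]
    (rk : P → ℕ) (hrk : ∀ a b : P, a ⋖ b → rk b = rk a + 1)
    (M : PartialMatching P) (hM : M.IsAcyclic)
    (f : P → ℤ) (hf : M.Faithful f)
    (γ γ' : FlowPath P) (hγ : γ.Valid M) (hγ' : γ'.Valid M)
    (hle : γ.Subpath γ') :
    f γ.tgt ≤ f γ'.tgt := by
  obtain ⟨k, φ, hk, hkl, hmono, -, hφk, -, hcell⟩ := hle
  have hlt : φ (k - 1) < φ k := hmono _ _ (by omega) le_rfl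
  have hlast := hcell k (φ k) hk le_rfl hlt le_rfl
  rw [hφk, Nat.add_sub_cancel, FlowPath.eAt_len] at hlast
  exact (hγ.apply_tgt_le hf (by omega)).trans (hf.le_of_le_critical hγ'.1 hlast)
end

section
/- Let μ be an acyclic partial matching on a finite graded poset P and γ, γ' flow paths with γ ⪯ γ' and τ(γ) = τ(γ'). Then ℓ(γ) ≤ ℓ(γ'). -/
theorem strictMono_of_covBy_imp_succ {P : Type} [PartialOrder P] [Fintype P] (rk : P → ℕ)
    (hrk : ∀ a b : P, a ⋖ b → rk b = rk a + 1) : StrictMono rk := by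
  classical
  let _ : LocallyFiniteOrder P := Fintype.toLocallyFiniteOrder
  exact (strictMono_iff_forall_covBy rk).2 fun a b h => by have := hrk a b h; omega

namespace FlowPath

variable {P : Type} [PartialOrder P]

/-- Every non-final cell of a flow path is matched. -/
theorem Valid.eAt_mem {M : PartialMatching P} {γ : FlowPath P} (h : γ.Valid M) {i : ℕ}
    (hi : i < γ.len) : γ.eAt i ∈ M.D ∪ M.U := by
  obtain ⟨hu, he | he, -⟩ := h.2 i hi
  · exact Or.inr (he ▸ hu)
  · exact Or.inl (he ▸ M.minv_mem _ hu)

/-- The rank does not increase along a flow path. -/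
theorem Valid.rk_tgt_le {M : PartialMatching P} {γ : FlowPath P} (h : γ.Valid M) {rk : P → ℕ}
    (hmono : StrictMono rk) (hrk : ∀ a b : P, a ⋖ b → rk b = rk a + 1) {i : ℕ}
    (hi : i ≤ γ.len) : rk γ.c ≤ rk (γ.eAt i) := by
  induction hi using Nat.decreasingInduction with
  | self => rw [eAt_len]
  | of_succ j hj ih =>
    obtain ⟨hu, he, hlt, -⟩ := h.2 j hj
    have h₁ := hmono hlt
    have h₂ := hrk _ _ (M.cov _ (M.minv_mem _ hu))
    rw [M.right_inv _ hu] at h₂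
    rcases he with he | he <;> rw [he] <;> omega

end FlowPath

/-- if `γ ⪯ γ'` and `τ(γ) = τ(γ')` then `ℓ(γ) ≤ ℓ(γ')`. -/
theorem stmt7 {P : Type} [PartialOrder P] [Fintype P]
    (rk : P → ℕ) (hrk : ∀ a b : P, a ⋖ b → rk b = rk a + 1)
    (M : PartialMatching P) (hM : M.IsAcyclic)
    (γ γ' : FlowPath P) (hγ : γ.Valid M) (hγ' : γ'.Valid M)
    (hle : γ.Subpath γ') (htgt : γ.tgt = γ'.tgt) :
    γ.len ≤ γ'.len := by
  obtain ⟨k, φ, hk1, hk, hφ, -, hφk, -, hcell⟩ := hle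
  have hmono := strictMono_of_covBy_imp_succ rk hrk
  have hkey : k = γ.len + 1 := by
    by_contra hne
    have hlt : k - 1 < γ.len := by omega
    have hlast := hcell k (φ k) hk1 le_rfl (hφ _ _ (by omega) le_rfl) le_rfl
    rw [hφk, Nat.add_sub_cancel, FlowPath.eAt_len] at hlast
    change _ ≤ γ'.tgt at hlast
    rw [← htgt] at hlast
    change _ ≤ γ.c at hlast
    have heq : γ.eAt (k - 1) = γ.c := by
      by_contra hc
      exact (hmono (lt_of_le_of_ne hlast hc)).not_ge (hγ.rk_tgt_le hmono hrk hlt.le)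
    exact hγ.1 (heq ▸ hγ.eAt_mem hlt)
  have hid : ∀ j, j ≤ k → j ≤ φ j := fun j => by
    induction j with
    | zero => simp
    | succ j ih =>
      intro hj
      have := hφ j (j + 1) (by omega) hj
      have := ih (by omega)
      omega
  have := hid k le_rfl
  omega
end

section
/- Let μ be an acyclic partial matching on a finite graded poset P. Then the relation ⪯ is a partial order on the set FP(μ) of flow paths: it is reflexive, transitive, and antisymmetric. -/
namespace FlowPath

variable {P : Type}

@[simp] theorem len_cons (a : P × P) (s : List (P × P)) (c : P) :
    len ⟨a :: s, c⟩ = len ⟨s, c⟩ + 1 := rfl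

@[simp] theorem eAt_cons_zero (a : P × P) (s : List (P × P)) (c : P) :
    eAt ⟨a :: s, c⟩ 0 = a.1 := rfl

@[simp] theorem eAt_cons_succ (a : P × P) (s : List (P × P)) (c : P) (i : ℕ) :
    eAt ⟨a :: s, c⟩ (i + 1) = eAt ⟨s, c⟩ i := by simp [eAt]

@[simp] theorem uAt_cons_zero (a : P × P) (s : List (P × P)) (c : P) :
    uAt ⟨a :: s, c⟩ 0 = a.2 := rfl

@[simp] theorem uAt_cons_succ (a : P × P) (s : List (P × P)) (c : P) (i : ℕ) :
    uAt ⟨a :: s, c⟩ (i + 1) = uAt ⟨s, c⟩ i := by simp [uAt]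

variable [PartialOrder P]

theorem Subpath.refl (γ : FlowPath P) : γ.Subpath γ := by
  refine ⟨γ.len + 1, id, by omega, le_rfl, fun i j h _ => h, rfl, rfl, fun _ _ _ => rfl, ?_⟩
  intro j p h₁ _ h₂ h₃
  have : p = j := by simp only [id] at h₂ h₃; omega
  rw [this]

theorem Subpath.trans {γ₁ γ₂ γ₃ : FlowPath P} (h₁₂ : γ₁.Subpath γ₂) (h₂₃ : γ₂.Subpath γ₃) :
    γ₁.Subpath γ₃ := by
  classical
  obtain ⟨k, φ, hk, hkl, hφ, hφ0, hφk, hφu, hφe⟩ := h₁₂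
  obtain ⟨l, ψ, hl, hll, hψ, hψ0, hψl, hψu, hψe⟩ := h₂₃
  have hex : ∃ j, l ≤ φ j := ⟨k, by omega⟩
  obtain ⟨k', hk', hmin⟩ : ∃ k', l ≤ φ k' ∧ ∀ j < k', φ j < l :=
    ⟨Nat.find hex, Nat.find_spec hex, fun j hj => not_le.mp (Nat.find_min hex hj)⟩
  have hk'k : k' ≤ k := by
    by_contra! h
    have := hmin k h
    omega
  have hk'1 : 1 ≤ k' := by
    by_contra! h
    have : k' = 0 := by omega
    subst this
    omega
  refine ⟨k', fun j => ψ (min (φ j) l), hk'1, by omega, ?_, ?_, ?_, ?_, ?_⟩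
  · intro i j hij hj
    have := hφ i j hij (by omega)
    have := hmin i (by omega)
    exact hψ _ _ (by omega) (by omega)
  · simp [hφ0, hψ0]
  · simp [hk', hψl]
  · intro j h1 hj
    have h := hmin j hj
    have h0 := hφ 0 j (by omega) (by omega)
    rw [hφu j h1 (by omega), hψu (φ j) (by omega) h]
    simp [h.le]
  · intro j p h1 hj hp hp'
    have hjl := hmin (j - 1) (by omega)
    have hex : ∃ q, p ≤ ψ q := ⟨_, hp'⟩
    obtain ⟨q, hq, hqmin⟩ : ∃ q, p ≤ ψ q ∧ ∀ r, p ≤ ψ r → q ≤ r :=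
      ⟨Nat.find hex, Nat.find_spec hex, fun r hr => Nat.find_min' hex hr⟩
    have hqle := hqmin _ hp'
    have hqlt : φ (j - 1) < q := by
      by_contra! h
      have hp : ψ (φ (j - 1)) < p := by simpa [hjl.le] using hp
      rcases h.eq_or_lt with h | h
      · rw [h] at hq; omega
      · have := hψ _ _ h hjl.le
        omega
    refine (hφe j q h1 (by omega) hqlt (by omega)).trans
      (hψe q p (by omega) (by omega) ?_ hq)
    by_contra! h
    have := hqmin _ h
    omega

theorem Subpath.eAt_zero_le {γ γ' : FlowPath P} (h : γ.Subpath γ') : γ.eAt 0 ≤ γ'.eAt 0 := by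
  obtain ⟨k, φ, hk, -, hφ, hφ0, -, -, hφe⟩ := h
  have := hφ 0 1 (by omega) hk
  exact hφe 1 1 le_rfl hk (by simp [hφ0]) (by omega)

theorem Valid.tail {M : PartialMatching P} {a : P × P} {s : List (P × P)} {c : P}
    (h : Valid M ⟨a :: s, c⟩) : Valid M ⟨s, c⟩ :=
  ⟨h.1, fun i hi => by simpa using h.2 (i + 1) (by simpa using hi)⟩

theorem Valid.fst_notMem_Cr {M : PartialMatching P} {a : P × P} {s : List (P × P)} {c : P}
    (h : Valid M ⟨a :: s, c⟩) : a.1 ∉ M.Cr := by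
  obtain ⟨hu, he, -⟩ := h.2 0 (by simp)
  simp only [eAt_cons_zero, uAt_cons_zero] at hu he
  intro hc
  rcases he with he | he
  · exact hc (Or.inr (he ▸ hu))
  · exact hc (Or.inl (he ▸ M.minv_mem _ hu))

theorem Valid.snd_eq {M : PartialMatching P} {a b : P × P} {s t : List (P × P)} {c c' : P}
    (h : Valid M ⟨a :: s, c⟩) (h' : Valid M ⟨b :: t, c'⟩) (hab : a.1 = b.1) : a.2 = b.2 := by
  obtain ⟨hu, he, -⟩ := h.2 0 (by simp)
  obtain ⟨hu', he', -⟩ := h'.2 0 (by simp)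
  simp only [eAt_cons_zero, uAt_cons_zero] at hu he hu' he'
  have hd := M.minv_mem _ hu
  have hd' := M.minv_mem _ hu'
  rcases he with he | he <;> rcases he' with he' | he'
  · rw [← he, ← he', hab]
  · exact (Set.disjoint_left.mp M.disj hd' (by rwa [← he', ← hab, he])).elim
  · exact (Set.disjoint_left.mp M.disj hd (by rwa [← he, hab, he'])).elim
  · rw [← M.right_inv _ hu, ← M.right_inv _ hu', ← he, ← he', hab]

theorem Valid.not_fst_le {M : PartialMatching P} {a : P × P} {s : List (P × P)} {c : P}
    (h : Valid M ⟨a :: s, c⟩) : ¬ a.1 ≤ eAt ⟨s, c⟩ 0 := by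
  obtain ⟨hu, he, hlt, hne⟩ := h.2 0 (by simp)
  simp only [eAt_cons_zero, uAt_cons_zero, eAt_cons_succ] at hu he hlt hne
  intro hle
  rcases he with he | he
  · exact (hlt.trans_le (he ▸ hle)).false
  · have hcov := M.cov _ (M.minv_mem _ hu)
    rw [M.right_inv _ hu] at hcov
    exact hcov.2 (lt_of_le_of_ne (he ▸ hle) hne.symm) hlt

theorem Subpath.tail {M : PartialMatching P} {a b : P × P} {s t : List (P × P)} {c c' : P}
    (h' : Valid M ⟨b :: t, c'⟩) (hab : a.1 = b.1)
    (h : Subpath ⟨a :: s, c⟩ ⟨b :: t, c'⟩) : Subpath ⟨s, c⟩ ⟨t, c'⟩ := by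
  obtain ⟨k, φ, hk, hkl, hφ, hφ0, hφk, hφu, hφe⟩ := h
  simp only [len_cons] at hkl hφk
  have h01 := hφ 0 1 (by omega) hk
  have h1 : φ 1 = 1 := by
    by_contra hne
    refine h'.not_fst_le ?_
    have := hφe 1 2 le_rfl hk (by simp [hφ0]) (by omega)
    simpa [hab] using this
  have hk2 : k ≠ 1 := by
    rintro rfl
    omega
  have hpos : ∀ j, 1 ≤ j → j ≤ k → 1 ≤ φ j := fun j hj hjk => by
    have := hφ 0 j (by omega) hjk
    omega
  refine ⟨k - 1, fun j => φ (j + 1) - 1, by omega, by omega, ?_, by simp [h1], ?_, ?_, ?_⟩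
  · intro i j hij hj
    have := hφ (i + 1) (j + 1) (by omega) (by omega)
    have := hpos (i + 1) (by omega) (by omega)
    dsimp only
    omega
  · have : k - 1 + 1 = k := by omega
    simp [this, hφk]
  · intro j hj hjk
    have hu := hφu (j + 1) (by omega) (by omega)
    have hlt := hφ 1 (j + 1) (by omega) (by omega)
    obtain ⟨i, rfl⟩ : ∃ i, j = i + 1 := ⟨j - 1, by omega⟩
    obtain ⟨q, hq⟩ : ∃ q, φ (i + 1 + 1) = q + 2 := ⟨φ (i + 1 + 1) - 2, by omega⟩
    simpa [hq] using hu
  · intro j p hj hjk hp hp'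
    obtain ⟨i, rfl⟩ : ∃ i, j = i + 1 := ⟨j - 1, by omega⟩
    obtain ⟨q, rfl⟩ : ∃ q, p = q + 1 := ⟨p - 1, by omega⟩
    simp only [Nat.add_sub_cancel] at hp hp'
    have he := hφe (i + 1 + 1) (q + 1 + 1) (by omega) (by omega)
      (by rw [Nat.add_sub_cancel]; omega) (by omega)
    simpa using he

theorem Subpath.antisymm {M : PartialMatching P} {γ γ' : FlowPath P} (hγ : γ.Valid M)
    (hγ' : γ'.Valid M) (h : γ.Subpath γ') (h' : γ'.Subpath γ) : γ = γ' := by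
  obtain ⟨s, c⟩ := γ
  obtain ⟨t, c'⟩ := γ'
  have he := le_antisymm h.eAt_zero_le h'.eAt_zero_le
  induction s generalizing t with
  | nil =>
    cases t with
    | nil => simpa [eAt] using he
    | cons b t =>
      have hb : c = b.1 := he
      exact (hγ'.fst_notMem_Cr (hb ▸ hγ.1)).elim
  | cons a s ih =>
    cases t with
    | nil =>
      have ha : a.1 = c' := he
      exact (hγ.fst_notMem_Cr (ha ▸ hγ'.1)).elim
    | cons b t =>
      have hab : a.1 = b.1 := he
      have ht := h.tail hγ' hab
      have ht' := h'.tail hγ hab.symm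
      have key := ih hγ.tail t hγ'.tail ht ht' (le_antisymm ht.eAt_zero_le ht'.eAt_zero_le)
      rw [FlowPath.mk.injEq] at key ⊢
      exact ⟨by rw [Prod.ext hab (hγ.snd_eq hγ' hab), key.1], key.2⟩

end FlowPath

/-- `⪯` is a partial order on the set of flow paths:
reflexive, transitive and antisymmetric. -/
theorem stmt9 {P : Type} [PartialOrder P] [Fintype P]
    (rk : P → ℕ) (hrk : ∀ a b : P, a ⋖ b → rk b = rk a + 1)
    (M : PartialMatching P) (hM : M.IsAcyclic) :
    (∀ γ : FlowPath P, γ.Valid M → γ.Subpath γ) ∧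
    (∀ γ₁ γ₂ γ₃ : FlowPath P, γ₁.Valid M → γ₂.Valid M → γ₃.Valid M →
      γ₁.Subpath γ₂ → γ₂.Subpath γ₃ → γ₁.Subpath γ₃) ∧
    (∀ γ γ' : FlowPath P, γ.Valid M → γ'.Valid M →
      γ.Subpath γ' → γ'.Subpath γ → γ = γ') := by
  exact ⟨fun γ _ => FlowPath.Subpath.refl γ, fun _ _ _ _ _ _ h h' => h.trans h',
    fun _ _ hγ hγ' h h' => FlowPath.Subpath.antisymm hγ hγ' h h'⟩
end
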